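/- Fix θ > 0 and H ∈ (1/2,1). Let X be a random variable with values in (0,+∞) such that E[X^{-H}] < +∞. Then E[(V_{2,H}(X))^{-1/2}] < +∞. -/

import Mathlib

open Real Filter Set MeasureTheory

/-- The variance of the fractional Ornstein–Uhlenbeck process with Hurst index `H ∈ (1/2,1)`
and drift parameter `1/θ`. -/
noncomputable def V2 (θ H t : ℝ) : ℝ :=
  Real.exp (-(2 * t) / θ) *
    ∫ u in (0:ℝ)..t, ∫ v in (0:ℝ)..t, Real.exp ((u + v) / θ) * |u - v| ^ (2 * H - 2)
lemma aux_rpow (p : ℝ) (hp : -1 < p) (a b : ℝ) :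
    IntervalIntegrable (fun w : ℝ => |w| ^ p) volume a b := by
  have key : ∀ c : ℝ, 0 ≤ c → IntervalIntegrable (fun w : ℝ => |w| ^ p) volume 0 c := by
    intro c hc
    refine (intervalIntegral.intervalIntegrable_rpow' hp (a := 0) (b := c)).congr ?_
    intro w hw
    rw [uIoc_of_le hc] at hw
    simp [abs_of_pos hw.1]
  have key2 : ∀ c : ℝ, IntervalIntegrable (fun w : ℝ => |w| ^ p) volume 0 c := by
    intro c
    rcases le_total 0 c with h | h
    · exact key c h
    · have := (key (-c) (by linarith)).comp_sub_left 0
      simpa using this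
  exact (key2 a).symm.trans (key2 b)

lemma aux_shift (p : ℝ) (hp : -1 < p) (u a b : ℝ) :
    IntervalIntegrable (fun v : ℝ => |u - v| ^ p) volume a b := by
  have := (aux_rpow p hp (u - a) (u - b)).comp_sub_left u
  simpa using this

lemma aux_inner (θ p : ℝ) (hp : -1 < p) (u a b : ℝ) :
    IntervalIntegrable (fun v : ℝ => Real.exp ((u + v) / θ) * |u - v| ^ p) volume a b :=
  (aux_shift p hp u a b).continuousOn_mul (by fun_prop)

noncomputable def auxG (θ p : ℝ) (z : ℝ × ℝ) : ℝ :=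
  ∫ v, (if 0 < v ∧ v ≤ z.1 then Real.exp ((z.2 + v) / θ) * |z.2 - v| ^ p else 0)

lemma auxG_sm (θ p : ℝ) : StronglyMeasurable (auxG θ p) := by
  unfold auxG
  refine StronglyMeasurable.integral_prod_right
    (f := fun (z : ℝ × ℝ) (v : ℝ) => (if 0 < v ∧ v ≤ z.1 then
      Real.exp ((z.2 + v) / θ) * |z.2 - v| ^ p else 0)) ?_
  apply Measurable.stronglyMeasurable
  unfold Function.uncurry
  refine Measurable.ite ?_ (by fun_prop) (by fun_prop)
  exact (measurableSet_lt measurable_const measurable_snd).inter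
    (measurableSet_le measurable_snd (measurable_fst.comp measurable_fst))

lemma aux_ite (f : ℝ → ℝ) (t : ℝ) (ht : 0 ≤ t) :
    ∫ v in (0:ℝ)..t, f v = ∫ v, (if 0 < v ∧ v ≤ t then f v else 0) := by
  rw [intervalIntegral.integral_of_le ht, ← integral_indicator measurableSet_Ioc]
  congr 1
  ext v
  simp [indicator_apply]

lemma auxG_eq (θ p t u : ℝ) (ht : 0 ≤ t) :
    ∫ v in (0:ℝ)..t, Real.exp ((u + v) / θ) * |u - v| ^ p = auxG θ p (t, u) :=
  aux_ite _ t ht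

lemma auxG_int (θ p t : ℝ) (hθ : 0 < θ) (hp : -1 < p) (ht : 0 ≤ t) :
    IntervalIntegrable (fun u => auxG θ p (t, u)) volume 0 t := by
  have hm : StronglyMeasurable (fun u => auxG θ p (t, u)) :=
    (auxG_sm θ p).comp_measurable (by fun_prop)
  refine (intervalIntegrable_const (c := Real.exp ((t + t) / θ) * ∫ w in (-t)..t, |w| ^ p)).mono_fun'
    hm.aestronglyMeasurable ?_
  refine (ae_restrict_mem measurableSet_uIoc).mono fun u hu => ?_
  rw [uIoc_of_le ht] at hu
  show ‖auxG θ p (t, u)‖ ≤ _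
  rw [← auxG_eq θ p t u ht, Real.norm_of_nonneg
    (intervalIntegral.integral_nonneg ht fun v _ => by positivity)]
  calc _ ≤ ∫ v in (0:ℝ)..t, Real.exp ((t + t) / θ) * |u - v| ^ p := by
        refine intervalIntegral.integral_mono_on ht (aux_inner θ p hp u 0 t)
          ((aux_shift p hp u 0 t).const_mul _) fun v hv => ?_
        gcongr
        · exact hu.2
        · exact hv.2
    _ = Real.exp ((t + t) / θ) * ∫ w in (u - t)..u, |w| ^ p := by
        rw [intervalIntegral.integral_const_mul,
          intervalIntegral.integral_comp_sub_left (fun w => |w| ^ p) u]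
        simp
    _ ≤ _ := by
        refine mul_le_mul_of_nonneg_left ?_ (Real.exp_pos _).le
        refine intervalIntegral.integral_mono_interval (by linarith [hu.1]) (by linarith) hu.2
          (Eventually.of_forall fun w => by simp; positivity) (aux_rpow p hp _ _)

lemma V2_lower (θ H t : ℝ) (hθ : 0 < θ) (hH : H ∈ Set.Ioo (1/2 : ℝ) 1) (ht : 0 < t) :
    Real.exp (-2 / θ) * (min t 1) ^ (2 * H) ≤ V2 θ H t := by
  have hp : -1 < 2 * H - 2 := by linarith [hH.1]
  have hp0 : 2 * H - 2 ≤ 0 := by linarith [hH.2]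
  set s := min t 1 with hs
  have hs0 : 0 < s := lt_min ht one_pos
  have hst : s ≤ t := min_le_left _ _
  have hs1 : s ≤ 1 := min_le_right _ _
  have inner : ∀ u ∈ Icc (t - s) t,
      s * (Real.exp ((2 * t - 2 * s) / θ) * s ^ (2 * H - 2)) ≤ auxG θ (2 * H - 2) (t, u) := by
    intro u hu
    rw [← auxG_eq _ _ _ _ ht.le]
    calc _ = ∫ v in (t - s)..t, Real.exp ((2 * t - 2 * s) / θ) * s ^ (2 * H - 2) := by simp; ring
      _ ≤ ∫ v in (t - s)..t, Real.exp ((u + v) / θ) * |u - v| ^ (2 * H - 2) := by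
        refine intervalIntegral.integral_mono_ae_restrict (by linarith) intervalIntegrable_const
          (aux_inner θ _ hp u _ _) ?_
        have h1 : ∀ᵐ v ∂(volume.restrict (Icc (t - s) t)), v ≠ u :=
          ae_restrict_of_ae (Measure.ae_ne volume u)
        filter_upwards [h1, ae_restrict_mem measurableSet_Icc] with v hv hv2
        have : 0 < |u - v| := abs_pos.2 (sub_ne_zero.2 (Ne.symm hv))
        have h2 : |u - v| ≤ s := abs_le.2 ⟨by linarith [hu.1, hv2.2], by linarith [hu.2, hv2.1]⟩
        have h3 := Real.rpow_le_rpow_of_nonpos this h2 hp0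
        have h4 : 2 * t - 2 * s ≤ u + v := by linarith [hu.1, hv2.1]
        show _ * _ ≤ _ * _
        gcongr
      _ ≤ _ := by
        refine intervalIntegral.integral_mono_interval (by linarith) (by linarith) le_rfl
          (Eventually.of_forall fun w => by simp; positivity) (aux_inner θ _ hp u _ _)
  have hGi := auxG_int θ (2 * H - 2) t hθ hp ht.le
  have outer : s * (s * (Real.exp ((2 * t - 2 * s) / θ) * s ^ (2 * H - 2)))
      ≤ ∫ u in (0:ℝ)..t, auxG θ (2 * H - 2) (t, u) := by
    calc _ = ∫ u in (t - s)..t, s * (Real.exp ((2 * t - 2 * s) / θ) * s ^ (2 * H - 2)) := by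
          rw [intervalIntegral.integral_const, smul_eq_mul]; ring
      _ ≤ ∫ u in (t - s)..t, auxG θ (2 * H - 2) (t, u) := by
        refine intervalIntegral.integral_mono_on (by linarith) intervalIntegrable_const
          (hGi.mono_set ?_) inner
        rw [uIcc_of_le (by linarith), uIcc_of_le ht.le]
        exact Icc_subset_Icc (by linarith) le_rfl
      _ ≤ _ := by
        refine intervalIntegral.integral_mono_interval (by linarith) (by linarith) le_rfl
          (Eventually.of_forall fun u => ?_) hGi
        show 0 ≤ auxG _ _ _
        rw [← auxG_eq _ _ _ _ ht.le]
        exact intervalIntegral.integral_nonneg ht.le fun v _ => by positivity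
  have hV : V2 θ H t = Real.exp (-(2 * t) / θ) * ∫ u in (0:ℝ)..t, auxG θ (2 * H - 2) (t, u) := by
    unfold V2
    simp_rw [auxG_eq _ _ _ _ ht.le]
  rw [hV]
  calc _ ≤ Real.exp (-(2 * s) / θ) * s ^ (2 * H) := by
        gcongr
        linarith
    _ = Real.exp (-(2 * t) / θ) *
        (s * (s * (Real.exp ((2 * t - 2 * s) / θ) * s ^ (2 * H - 2)))) := by
        have e1 : Real.exp (-(2 * s) / θ)
            = Real.exp (-(2 * t) / θ) * Real.exp ((2 * t - 2 * s) / θ) := by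
          rw [← Real.exp_add]; congr 1; ring
        have e2 : s ^ (2 * H) = s * (s * s ^ (2 * H - 2)) := by
          have : s ^ (2 * H) = s ^ (2 * H - 2) * s ^ (2:ℝ) := by
            rw [← Real.rpow_add hs0]; congr 1; ring
          rw [this, Real.rpow_two]; ring
        rw [e1, e2]; ring
    _ ≤ _ := by gcongr

lemma V2_bound (θ H t : ℝ) (hθ : 0 < θ) (hH : H ∈ Set.Ioo (1/2 : ℝ) 1) (ht : 0 < t) :
    ‖V2 θ H t ^ (-(1:ℝ)/2)‖ ≤ Real.exp (1 / θ) * (t ^ (-H) + 1) := by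
  have hl := V2_lower θ H t hθ hH ht
  have hs0 : 0 < min t 1 := lt_min ht one_pos
  have hpos : 0 < Real.exp (-2 / θ) * (min t 1) ^ (2 * H) := by positivity
  rw [Real.norm_of_nonneg (Real.rpow_nonneg (hpos.le.trans hl) _)]
  calc _ ≤ (Real.exp (-2 / θ) * (min t 1) ^ (2 * H)) ^ (-(1:ℝ)/2) :=
        Real.rpow_le_rpow_of_nonpos hpos hl (by norm_num)
    _ = Real.exp (1 / θ) * (min t 1) ^ (-H) := by
        rw [Real.mul_rpow (by positivity) (by positivity), ← Real.exp_mul, ← Real.rpow_mul hs0.le]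
        congr 2 <;> ring
    _ ≤ _ := by
        gcongr
        rcases le_total t 1 with h | h
        · rw [min_eq_left h]; linarith
        · rw [min_eq_right h, Real.one_rpow]
          linarith [Real.rpow_nonneg ht.le (-H)]

/-- If `X` is a positive random variable with `E[X^{-H}] < ∞`, then
`E[(V_{2,H}(X))^{-1/2}] < ∞`. -/
theorem integrable_inv_sqrt_V2 {Ω : Type*} [MeasurableSpace Ω]
    (ℙ : Measure Ω) [IsProbabilityMeasure ℙ]
    (θ : ℝ) (hθ : 0 < θ) (H : ℝ) (hH : H ∈ Set.Ioo (1/2 : ℝ) 1)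
    (X : Ω → ℝ) (hXm : Measurable X) (hXpos : ∀ᵐ ω ∂ℙ, X ω ∈ Set.Ioi (0:ℝ))
    (hmom : Integrable (fun ω => X ω ^ (-H)) ℙ) :
    Integrable (fun ω => (V2 θ H (X ω)) ^ (-(1:ℝ)/2)) ℙ := by
  have hM : StronglyMeasurable (fun t : ℝ =>
      ∫ u, (if 0 < u ∧ u ≤ t then auxG θ (2 * H - 2) (t, u) else 0)) := by
    refine StronglyMeasurable.integral_prod_right
      (f := fun (t u : ℝ) => (if 0 < u ∧ u ≤ t then auxG θ (2 * H - 2) (t, u) else 0)) ?_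
    apply Measurable.stronglyMeasurable
    unfold Function.uncurry
    refine Measurable.ite ?_ (auxG_sm θ _).measurable (by fun_prop)
    exact (measurableSet_lt measurable_const measurable_snd).inter
      (measurableSet_le measurable_snd measurable_fst)
  have hW : Measurable (fun t : ℝ => (Real.exp (-(2 * t) / θ) *
      ∫ u, (if 0 < u ∧ u ≤ t then auxG θ (2 * H - 2) (t, u) else 0)) ^ (-(1:ℝ)/2)) := by
    have := hM.measurable
    fun_prop
  have hdom : Integrable (fun ω => Real.exp (1 / θ) * (X ω ^ (-H) + 1)) ℙ :=
    (hmom.add (integrable_const 1)).const_mul _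
  refine hdom.mono' ((hW.comp hXm).aestronglyMeasurable.congr ?_) ?_
  · filter_upwards [hXpos] with ω hω
    have h0 : 0 ≤ X ω := le_of_lt hω
    simp only [Function.comp, V2]
    simp_rw [auxG_eq _ _ _ _ h0]
    rw [aux_ite _ _ h0]
  · filter_upwards [hXpos] with ω hω
    exact V2_bound θ H _ hθ hH hω
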